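/- For the Sibuya squirrel random walk with μ ∈ (0,1), the generating function of the expected position equals X̄⁽¹⁾(u) = σ̃₀·[(1-u)^{μ-2}/(2-(1-u)^μ) - 1/(1-u)], and as u → 1⁻, X̄⁽¹⁾(u) ~ (σ̃₀/2)·(1-u)^{μ-2}; consequently ⟨X_t⟩ ~ (σ̃₀/2)·t^{1-μ}/Γ(2-μ) as t → ∞. -/

import Mathlib

open Filter Set

/-- The power series `P` converges absolutely at `u`, with sum `s`. -/
def AbsHasSum (P : PowerSeries ℝ) (u s : ℝ) : Prop :=
  Summable (fun n => ‖PowerSeries.coeff n P * u ^ n‖) ∧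
    HasSum (fun n => PowerSeries.coeff n P * u ^ n) s

namespace AbsHasSum

variable {P Q : PowerSeries ℝ} {u s t : ℝ}

lemma add (hP : AbsHasSum P u s) (hQ : AbsHasSum Q u t) : AbsHasSum (P + Q) u (s + t) := by
  have h := hP.2.add hQ.2
  simp only [← add_mul, ← map_add] at h
  exact ⟨h.summable.norm, h⟩

lemma mul (hP : AbsHasSum P u s) (hQ : AbsHasSum Q u t) : AbsHasSum (P * Q) u (s * t) := by
  have key : ∀ n, ∑ kl ∈ Finset.HasAntidiagonal.antidiagonal n, (PowerSeries.coeff kl.1 P * u ^ kl.1) *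
      (PowerSeries.coeff kl.2 Q * u ^ kl.2) = PowerSeries.coeff n (P * Q) * u ^ n := by
    intro n
    rw [PowerSeries.coeff_mul, Finset.sum_mul]
    refine Finset.sum_congr rfl fun kl hkl => ?_
    rw [← Finset.HasAntidiagonal.mem_antidiagonal.mp hkl, pow_add]
    ring
  have h1 := summable_norm_sum_mul_antidiagonal_of_summable_norm hP.1 hQ.1
  have h2 := tsum_mul_tsum_eq_tsum_sum_antidiagonal_of_summable_norm hP.1 hQ.1
  simp only [key] at h1 h2
  rw [hP.2.tsum_eq, hQ.2.tsum_eq] at h2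
  exact ⟨h1, h2 ▸ h1.of_norm.hasSum⟩

lemma const (r u : ℝ) : AbsHasSum (PowerSeries.C r) u r := by
  have h : HasSum (fun n => PowerSeries.coeff n (PowerSeries.C r) * u ^ n) r := by
    convert hasSum_single (f := fun n => PowerSeries.coeff n (PowerSeries.C r) * u ^ n) 0
      fun n hn => by simp [PowerSeries.coeff_C, hn] using 1
    simp
  exact ⟨h.summable.norm, h⟩

lemma one (u : ℝ) : AbsHasSum 1 u 1 := by
  simpa using const 1 u

lemma sub (hP : AbsHasSum P u s) (hQ : AbsHasSum Q u t) : AbsHasSum (P - Q) u (s - t) := by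
  have h := hP.2.sub hQ.2
  simp only [← sub_mul, ← map_sub] at h
  exact ⟨h.summable.norm, h⟩

/-- Power series with the same sums on `(0, 1)` are equal. -/
lemma ext {f : ℝ → ℝ} (hP : ∀ u ∈ Ioo (0 : ℝ) 1, AbsHasSum P u (f u))
    (hQ : ∀ u ∈ Ioo (0 : ℝ) 1, AbsHasSum Q u (f u)) : P = Q := by
  have hD : ∀ u ∈ Ioo (0 : ℝ) 1, AbsHasSum (P - Q) u 0 := fun u hu => by
    simpa using (hP u hu).sub (hQ u hu)
  set c : ℕ → ℝ := fun n => PowerSeries.coeff n (P - Q) with hc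
  set p := FormalMultilinearSeries.ofScalars ℝ c with hp
  have hr : 0 < p.radius := by
    refine lt_of_lt_of_le (b := ((1 / 2 : NNReal) : ENNReal)) (by simp) ?_
    refine p.le_radius_of_summable_norm ?_
    have := (hD (1 / 2) (by norm_num)).1
    refine this.of_nonneg_of_le (fun n => by positivity) fun n => ?_
    rw [norm_mul, norm_pow]
    have : ‖p n‖ ≤ ‖c n‖ := by simp [hp]
    refine (mul_le_mul_of_nonneg_right this (by positivity)).trans (le_of_eq ?_)
    simp [hc]
  have hps := (p.hasFPowerSeriesOnBall hr).hasFPowerSeriesAt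
  have hz : ∀ᶠ x in nhds (0 : ℝ), p.sum x = 0 := by
    rw [← hps.analyticAt.frequently_zero_iff_eventually_zero]
    have : ∃ᶠ x in nhdsWithin (0 : ℝ) (Ioi 0), p.sum x = 0 := by
      refine Eventually.frequently ?_
      filter_upwards [Ioo_mem_nhdsGT (zero_lt_one' ℝ)] with x hx
      have := (hD x hx).2.tsum_eq
      rw [← this]
      exact FormalMultilinearSeries.ofScalars_sum_eq c x
    exact this.filter_mono (nhdsWithin_mono _ fun x hx => ne_of_gt hx)
  have h0 : p = 0 := hps.eq_zero_of_eventually hz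
  rw [hp, FormalMultilinearSeries.ofScalars_series_eq_zero] at h0
  rw [← sub_eq_zero]
  ext n
  exact congrFun h0 n

/-- Inverting `1 - W` preserves absolute convergence at `1` when the coefficients of `W` have
`ℓ¹`-norm less than one. -/
lemma summable_of_eq_one_add_mul {W Y : PowerSeries ℝ} {r : ℝ}
    (hW : HasSum (fun n => |PowerSeries.coeff n W|) r) (hr : r < 1) (hY : Y = 1 + W * Y) :
    Summable fun n => |PowerSeries.coeff n Y| := by
  set y := fun n => |PowerSeries.coeff n Y| with hy
  have hr0 : 0 ≤ r := hW.nonneg fun _ => abs_nonneg _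
  refine summable_of_sum_range_le (c := 1 / (1 - r)) (fun n => abs_nonneg _) fun n => ?_
  have hle : ∀ k, y k ≤ (if k = 0 then 1 else 0) +
      ∑ i ∈ Finset.range (k + 1), |PowerSeries.coeff i W| * y (k - i) := by
    intro k
    have : PowerSeries.coeff k Y = (if k = 0 then 1 else 0) +
        ∑ i ∈ Finset.range (k + 1), PowerSeries.coeff i W * PowerSeries.coeff (k - i) Y := by
      conv_lhs => rw [hY]
      rw [map_add, PowerSeries.coeff_one, PowerSeries.coeff_mul,
        Finset.Nat.sum_antidiagonal_eq_sum_range_succ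
          (fun i j => PowerSeries.coeff i W * PowerSeries.coeff j Y)]
    rw [hy]
    simp only
    rw [this]
    refine (abs_add_le _ _).trans (add_le_add (by split_ifs <;> simp) ?_)
    refine (Finset.abs_sum_le_sum_abs _ _).trans (le_of_eq ?_)
    exact Finset.sum_congr rfl fun i _ => abs_mul _ _
  have hS : ∑ k ∈ Finset.range n, y k ≤ 1 + r * ∑ k ∈ Finset.range n, y k := by
    calc ∑ k ∈ Finset.range n, y k
        ≤ ∑ k ∈ Finset.range n, ((if k = 0 then (1 : ℝ) else 0) +
          ∑ i ∈ Finset.range (k + 1), |PowerSeries.coeff i W| * y (k - i)) :=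
          Finset.sum_le_sum fun k _ => hle k
      _ ≤ 1 + r * ∑ k ∈ Finset.range n, y k := by
          rw [Finset.sum_add_distrib]
          refine add_le_add ?_ ?_
          · rw [Finset.sum_ite_eq']
            split_ifs <;> simp
          · simp only [Finset.range_eq_Ico]
            rw [Finset.sum_sigma', Finset.sum_nbij' (t := (Finset.Ico 0 n).sigma
              fun i => Finset.Ico 0 (n - i)) (g := fun x => |PowerSeries.coeff x.1 W| * y x.2)
              (fun x => ⟨x.2, x.1 - x.2⟩) (fun x => ⟨x.1 + x.2, x.1⟩)]
            · rw [Finset.sum_sigma]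
              have h1 : ∀ i ∈ Finset.Ico 0 n, ∑ j ∈ Finset.Ico 0 (n - i),
                  |PowerSeries.coeff i W| * y j ≤
                  |PowerSeries.coeff i W| * ∑ j ∈ Finset.Ico 0 n, y j := by
                intro i _
                rw [← Finset.mul_sum]
                refine mul_le_mul_of_nonneg_left ?_ (abs_nonneg _)
                exact Finset.sum_le_sum_of_subset_of_nonneg
                  (Finset.Ico_subset_Ico_right (by omega)) fun _ _ _ => abs_nonneg _
              refine (Finset.sum_le_sum h1).trans ?_
              rw [← Finset.sum_mul]
              refine mul_le_mul_of_nonneg_right ?_ (Finset.sum_nonneg fun _ _ => abs_nonneg _)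
              exact sum_le_hasSum _ (fun _ _ => abs_nonneg _) hW
            all_goals
              rintro ⟨i, j⟩ h
              simp at h ⊢
              try omega
  rw [le_div_iff₀ (by linarith)]
  linarith

end AbsHasSum

/-- If `b` is positive, monotone and `b n / b (n + 1) → 1`, then convolving `b` with an absolutely
summable sequence multiplies it asymptotically by the sum of that sequence. -/
lemma tendsto_convolution_div {b h : ℕ → ℝ} {s : ℝ} (hb : ∀ n, 0 < b n) (hmono : Monotone b)
    (hratio : Tendsto (fun n => b n / b (n + 1)) atTop (nhds 1))
    (hh : Summable fun n => ‖h n‖) (hs : HasSum h s) :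
    Tendsto (fun n => (∑ k ∈ Finset.range (n + 1), h k * b (n - k)) / b n) atTop (nhds s) := by
  have hk : ∀ k, Tendsto (fun n => b n / b (n + k)) atTop (nhds 1) := by
    intro k
    induction k with
    | zero => simp [div_self (hb _).ne']
    | succ k ih =>
      have h2 := ih.mul (hratio.comp (tendsto_add_atTop_nat k))
      rw [one_mul] at h2
      refine h2.congr fun n => ?_
      simp only [Function.comp]
      rw [div_mul_div_cancel₀ (hb _).ne', add_assoc]
  have key := tendsto_tsum_of_dominated_convergence (𝓕 := atTop)
    (f := fun n k => if k ≤ n then h k * (b (n - k) / b n) else 0) (g := h) hh ?_ ?_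
  · rw [hs.tsum_eq] at key
    refine key.congr fun n => ?_
    rw [tsum_eq_sum (s := Finset.range (n + 1)), Finset.sum_div]
    · refine Finset.sum_congr rfl fun k hk => ?_
      rw [if_pos (by simpa [Nat.lt_succ_iff] using hk), mul_div_assoc]
    · intro k hk
      rw [if_neg]
      simpa using hk
  · intro k
    rw [← tendsto_add_atTop_iff_nat k]
    simpa using (hk k).const_mul (h k)
  · refine Eventually.of_forall fun n k => ?_
    split_ifs
    · rw [norm_mul]
      refine mul_le_of_le_one_right (norm_nonneg _) ?_
      rw [Real.norm_of_nonneg (div_nonneg (hb _).le (hb _).le), div_le_one (hb _)]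
      exact hmono (Nat.sub_le _ _)
    · simp

lemma multichoose_succ_mul (s : ℝ) (n : ℕ) :
    (n + 1) * Ring.multichoose s (n + 1) = (s + n) * Ring.multichoose s n := by
  have h1 := Ring.factorial_nsmul_multichoose_eq_ascPochhammer s (n + 1)
  have h0 := Ring.factorial_nsmul_multichoose_eq_ascPochhammer s n
  rw [ascPochhammer_succ_right, Polynomial.smeval_mul, ← h0, Nat.factorial_succ] at h1
  simp only [nsmul_eq_mul, Polynomial.smeval_add, Polynomial.smeval_X, pow_one,
    Polynomial.smeval_natCast, pow_zero, Nat.cast_mul, Nat.cast_add, Nat.cast_one, mul_one] at h1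
  have hf : (n.factorial : ℝ) ≠ 0 := by positivity
  apply mul_left_cancel₀ hf
  linarith

lemma multichoose_eq_prod_div (s : ℝ) (n : ℕ) :
    Ring.multichoose s n = (∏ j ∈ Finset.range n, (s + j)) / n.factorial := by
  induction n with
  | zero => simp
  | succ n ih =>
    have h := multichoose_succ_mul s n
    have hn : (n : ℝ) + 1 ≠ 0 := by positivity
    have hf : (n.factorial : ℝ) ≠ 0 := by positivity
    rw [ih] at h
    rw [Finset.prod_range_succ, Nat.factorial_succ, eq_div_iff (by positivity)]
    push_cast
    field_simp at h
    linarith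

lemma multichoose_pos {s : ℝ} (hs : 0 < s) (n : ℕ) : 0 < Ring.multichoose s n := by
  rw [multichoose_eq_prod_div]
  have : 0 < ∏ j ∈ Finset.range n, (s + j) := Finset.prod_pos fun j _ => by positivity
  positivity

lemma tendsto_multichoose_div {s : ℝ} (hs : 0 < s) :
    Tendsto (fun n : ℕ => Ring.multichoose s n / (n : ℝ) ^ (s - 1)) atTop
      (nhds (1 / Real.Gamma s)) := by
  have h1 : Tendsto (fun n : ℕ => 1 / Real.GammaSeq s n) atTop (nhds (1 / Real.Gamma s)) :=
    (tendsto_const_nhds).div (Real.GammaSeq_tendsto_Gamma s) (Real.Gamma_pos_of_pos hs).ne'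
  have h2 : Tendsto (fun n : ℕ => (n : ℝ) / (n + s)) atTop (nhds 1) :=
    tendsto_natCast_div_add_atTop s
  have h3 := h1.mul h2
  rw [mul_one] at h3
  refine h3.congr' ?_
  filter_upwards [eventually_gt_atTop 0] with n hn
  have hn' : (0 : ℝ) < n := by exact_mod_cast hn
  have hp : 0 < ∏ j ∈ Finset.range n, (s + j) := Finset.prod_pos fun j _ => by positivity
  have hpow : 0 < (n : ℝ) ^ s := Real.rpow_pos_of_pos hn' _
  have hns : 0 < (n : ℝ) + s := by positivity
  rw [multichoose_eq_prod_div, Real.GammaSeq, Finset.prod_range_succ, Real.rpow_sub_one hn'.ne',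
    add_comm s (n : ℝ)]
  field_simp

lemma absHasSum_multichoose (s : ℝ) {u : ℝ} (hu : |u| < 1) :
    AbsHasSum (PowerSeries.mk (Ring.multichoose s)) u ((1 - u) ^ (-s)) := by
  have h := Real.one_div_one_sub_rpow_hasFPowerSeriesOnBall_zero s
  have h2 := h.hasSum (y := u) (by simpa [enorm_eq_nnnorm, ← NNReal.coe_lt_coe] using hu)
  have h3 : HasSum (fun n => PowerSeries.coeff n (PowerSeries.mk (Ring.multichoose s)) * u ^ n)
      ((1 - u) ^ (-s)) := by
    convert! h2 using 1
    · ext n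
      simp [FormalMultilinearSeries.ofScalars, Ring.multichoose_eq]
    · rw [zero_add, Real.rpow_neg (by linarith [(abs_lt.mp hu).2]), one_div]
  exact ⟨h3.summable.norm, h3⟩

lemma sum_multichoose_neg (μ : ℝ) (n : ℕ) :
    ∑ k ∈ Finset.range (n + 1), Ring.multichoose (-μ) k = Ring.multichoose (1 - μ) n := by
  induction n with
  | zero => simp
  | succ n ih =>
    rw [Finset.sum_range_succ, ih]
    have := Ring.multichoose_succ_succ (-μ) n
    rw [show -μ + 1 = 1 - μ by ring] at this
    linarith

lemma multichoose_neg_succ_neg {μ : ℝ} (hμ : μ ∈ Ioo (0 : ℝ) 1) (n : ℕ) :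
    Ring.multichoose (-μ) (n + 1) < 0 := by
  induction n with
  | zero => simpa using hμ.1
  | succ n ih =>
    have h := multichoose_succ_mul (-μ) (n + 1)
    push_cast at h
    have h1 : 0 < -μ + (n + 1) := by have : (0 : ℝ) ≤ n := n.cast_nonneg; linarith [hμ.2]
    have h2 := mul_neg_of_pos_of_neg h1 ih
    rw [← h] at h2
    exact (pos_iff_neg_of_mul_neg h2).mp (by positivity)

lemma tendsto_multichoose_one_sub {μ : ℝ} (hμ : μ ∈ Ioo (0 : ℝ) 1) :
    Tendsto (fun n : ℕ => Ring.multichoose (1 - μ) n) atTop (nhds 0) := by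
  have h1 := tendsto_multichoose_div (s := 1 - μ) (by linarith [hμ.2])
  have h2 : Tendsto (fun n : ℕ => (n : ℝ) ^ (-μ)) atTop (nhds 0) :=
    (tendsto_rpow_neg_atTop hμ.1).comp tendsto_natCast_atTop_atTop
  have h3 := h1.mul h2
  rw [mul_zero] at h3
  refine h3.congr' ?_
  filter_upwards [eventually_gt_atTop 0] with n hn
  have hn' : (0 : ℝ) < n := by exact_mod_cast hn
  rw [show 1 - μ - 1 = -μ by ring]
  exact div_mul_cancel₀ _ (Real.rpow_pos_of_pos hn' _).ne'

lemma hasSum_neg_multichoose_neg_succ {μ : ℝ} (hμ : μ ∈ Ioo (0 : ℝ) 1) :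
    HasSum (fun n => -Ring.multichoose (-μ) (n + 1)) 1 := by
  rw [hasSum_iff_tendsto_nat_of_nonneg fun n => by linarith [multichoose_neg_succ_neg hμ n]]
  have h := (tendsto_multichoose_one_sub hμ).const_sub 1
  rw [sub_zero] at h
  refine h.congr fun n => ?_
  rw [← sum_multichoose_neg, Finset.sum_range_succ']
  simp

lemma hasSum_multichoose_neg {μ : ℝ} (hμ : μ ∈ Ioo (0 : ℝ) 1) :
    HasSum (fun n => Ring.multichoose (-μ) n) 0 := by
  rw [← hasSum_nat_add_iff' 1]
  simpa using (hasSum_neg_multichoose_neg_succ hμ).neg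

lemma hasSum_abs_multichoose_neg {μ : ℝ} (hμ : μ ∈ Ioo (0 : ℝ) 1) :
    HasSum (fun n => |Ring.multichoose (-μ) n|) 2 := by
  rw [← hasSum_nat_add_iff' 1]
  convert! hasSum_neg_multichoose_neg_succ hμ using 1
  · ext n
    exact abs_of_neg (multichoose_neg_succ_neg hμ n)
  · norm_num

/-- The coefficients of `(1 - X)^(2μ) / 4` have `ℓ¹`-norm less than one. -/
lemma exists_hasSum_abs_coeff_sq {μ : ℝ} (hμ : μ ∈ Ioo (0 : ℝ) 1) :
    ∃ r < 1, HasSum (fun n => |PowerSeries.coeff n (PowerSeries.C (1 / 4 : ℝ) *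
      (PowerSeries.mk (Ring.multichoose (-μ)) * PowerSeries.mk (Ring.multichoose (-μ))))|) r := by
  set D : PowerSeries ℝ := PowerSeries.mk (Ring.multichoose (-μ)) with hD
  set A : PowerSeries ℝ := PowerSeries.mk fun n => |Ring.multichoose (-μ) n| with hA
  have hAs : AbsHasSum A 1 2 := by
    have h := hasSum_abs_multichoose_neg hμ
    have h' : HasSum (fun n => PowerSeries.coeff n A * 1 ^ n) 2 := by simpa [hA] using h
    exact ⟨h'.summable.norm, h'⟩
  have hB := ((AbsHasSum.const (1 / 4) 1).mul (hAs.mul hAs)).2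
  norm_num at hB
  have hle : ∀ n, |PowerSeries.coeff n (PowerSeries.C (1 / 4 : ℝ) * (D * D))| ≤
      1 / 4 * PowerSeries.coeff n (A * A) := by
    intro n
    rw [PowerSeries.coeff_C_mul, abs_mul, abs_of_pos (by norm_num : (0 : ℝ) < 1 / 4),
      PowerSeries.coeff_mul, PowerSeries.coeff_mul]
    refine mul_le_mul_of_nonneg_left ?_ (by norm_num)
    refine (Finset.abs_sum_le_sum_abs _ _).trans (le_of_eq ?_)
    exact Finset.sum_congr rfl fun i _ => by simp [hA, hD, abs_mul]
  have hB' : HasSum (fun n => 1 / 4 * PowerSeries.coeff n (A * A)) 1 := by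
    convert hB using 1
  have hsum := hB'.summable.of_nonneg_of_le (fun _ => abs_nonneg _) hle
  refine ⟨_, ?_, hsum.hasSum⟩
  refine hasSum_lt hle (i := 2) ?_ hsum.hasSum hB'
  have h2 : Ring.multichoose (-μ) 2 = -(μ * (1 - μ)) / 2 := by
    have := multichoose_succ_mul (-μ) 1
    norm_num at this
    linarith
  have hx : 0 < μ * (1 - μ) := mul_pos hμ.1 (by linarith [hμ.2])
  rw [PowerSeries.coeff_C_mul, abs_mul, abs_of_pos (by norm_num : (0 : ℝ) < 1 / 4),
    PowerSeries.coeff_mul, PowerSeries.coeff_mul]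
  refine mul_lt_mul_of_pos_left ?_ (by norm_num)
  simp only [Finset.Nat.antidiagonal_succ, Finset.Nat.antidiagonal_zero, Finset.map_singleton,
    Finset.sum_cons, Finset.map_cons, Finset.sum_singleton, hA, hD, PowerSeries.coeff_mk]
  simp [h2, abs_div, abs_of_pos hμ.1, abs_of_pos (sub_pos.mpr hμ.2)]
  rw [abs_lt]
  constructor <;> nlinarith [hμ.1, hμ.2, mul_pos hμ.1 hμ.1]

/-- The reciprocal of `2 - (1 - X)^μ` has absolutely summable coefficients, with sum `1 / 2`. -/
lemma exists_inverse_two_sub {μ : ℝ} (hμ : μ ∈ Ioo (0 : ℝ) 1) :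
    ∃ H : PowerSeries ℝ, AbsHasSum H 1 (1 / 2) ∧
      (PowerSeries.C 2 - PowerSeries.mk (Ring.multichoose (-μ))) * H = 1 := by
  obtain ⟨r, hr, hW⟩ := exists_hasSum_abs_coeff_sq hμ
  set D : PowerSeries ℝ := PowerSeries.mk (Ring.multichoose (-μ)) with hD
  set W := PowerSeries.C (1 / 4 : ℝ) * (D * D) with hWdef
  have hDs : AbsHasSum D 1 0 := by
    have h : HasSum (fun n => PowerSeries.coeff n D * 1 ^ n) 0 := by
      simpa [hD] using hasSum_multichoose_neg hμ
    exact ⟨h.summable.norm, h⟩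
  have hWs : AbsHasSum W 1 0 := by
    simpa only [mul_zero] using (AbsHasSum.const (1 / 4) 1).mul (hDs.mul hDs)
  have hY : (1 - W) * (1 - W)⁻¹ = 1 := by
    refine PowerSeries.mul_inv_cancel _ ?_
    rw [map_sub, map_one, hWdef, map_mul, map_mul, PowerSeries.constantCoeff_C, hD,
      ← PowerSeries.coeff_zero_eq_constantCoeff_apply, PowerSeries.coeff_mk]
    norm_num
  set Y := (1 - W)⁻¹
  have hYs := AbsHasSum.summable_of_eq_one_add_mul hW hr (Y := Y) (by linear_combination hY)
  have hY1 : AbsHasSum Y 1 (∑' n, PowerSeries.coeff n Y) := by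
    have h : Summable fun n => PowerSeries.coeff n Y := hYs.of_abs
    exact ⟨by simpa using hYs, by simpa using h.hasSum⟩
  have hval : ∑' n, PowerSeries.coeff n Y = 1 := by
    have h := ((AbsHasSum.one 1).sub hWs).mul hY1
    rw [hY] at h
    simpa using h.2.unique (AbsHasSum.one 1).2
  rw [hval] at hY1
  refine ⟨PowerSeries.C (1 / 4) * ((PowerSeries.C 2 + D) * Y), ?_, ?_⟩
  · have h := (AbsHasSum.const (1 / 4) 1).mul (((AbsHasSum.const 2 1).add hDs).mul hY1)
    norm_num at h
    convert h using 2
  · have h4 : PowerSeries.C (1 / 4 : ℝ) * (PowerSeries.C 2 * PowerSeries.C 2) = 1 := by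
      rw [← map_mul, ← map_mul]
      norm_num
    linear_combination hY + Y * h4

lemma tendsto_of_eq_convolution {μ σ0 : ℝ} (hμ : μ ∈ Ioo (0 : ℝ) 1) (hσ : σ0 ≠ 0) {a : ℕ → ℝ}
    {H : PowerSeries ℝ} (hH : AbsHasSum H 1 (1 / 2))
    (ha : ∀ n, a n + σ0 = σ0 * PowerSeries.coeff n
      (H * PowerSeries.mk (Ring.multichoose (2 - μ)))) :
    Tendsto (fun t : ℕ => a t / (σ0 / 2 * (t : ℝ) ^ (1 - μ) / Real.Gamma (2 - μ)))
      atTop (nhds 1) := by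
  have hs : 0 < 2 - μ := by linarith [hμ.2]
  set b : ℕ → ℝ := Ring.multichoose (2 - μ) with hb
  have hbpos : ∀ n, 0 < b n := multichoose_pos hs
  have hrec : ∀ n : ℕ, b n / b (n + 1) = (n + 1) / (n + (2 - μ)) := fun n => by
    have h := multichoose_succ_mul (2 - μ) n
    have : 0 < (n : ℝ) + (2 - μ) := by positivity
    rw [div_eq_div_iff (hbpos _).ne' this.ne']
    linarith
  have hmono : Monotone b := monotone_nat_of_le_succ fun n => by
    rw [← div_le_one (hbpos _), hrec, div_le_one (by positivity)]
    linarith [hμ.2]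
  have hratio : Tendsto (fun n => b n / b (n + 1)) atTop (nhds 1) := by
    simp only [hrec]
    have h1 : Tendsto (fun n : ℕ => (n : ℝ) / (n + (2 - μ))) atTop (nhds 1) :=
      tendsto_natCast_div_add_atTop _
    have h2 : Tendsto (fun n : ℕ => 1 / ((n : ℝ) + (2 - μ))) atTop (nhds 0) :=
      tendsto_const_nhds.div_atTop
        (tendsto_atTop_add_const_right _ _ tendsto_natCast_atTop_atTop)
    simpa [add_div] using h1.add h2
  have hconv := tendsto_convolution_div hbpos hmono hratio (h := fun n => PowerSeries.coeff n H)
    (s := 1 / 2) (by simpa using hH.1) (by simpa using hH.2)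
  have hbn := tendsto_multichoose_div hs
  have hG := Real.Gamma_pos_of_pos hs
  have hpow : Tendsto (fun n : ℕ => (n : ℝ) ^ (1 - μ)) atTop atTop :=
    (tendsto_rpow_atTop (by linarith [hμ.2])).comp tendsto_natCast_atTop_atTop
  have h1 := ((hconv.mul hbn).sub (tendsto_const_nhds (x := (1 : ℝ)).div_atTop hpow)).const_mul
    (2 * Real.Gamma (2 - μ))
  have hlim : 2 * Real.Gamma (2 - μ) * (1 / 2 * (1 / Real.Gamma (2 - μ)) - 0) = 1 := by
    field_simp
    ring
  rw [hlim] at h1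
  refine h1.congr' ?_
  filter_upwards [eventually_gt_atTop 0] with n hn
  have hn' : (0 : ℝ) < n := by exact_mod_cast hn
  have hp : 0 < (n : ℝ) ^ (1 - μ) := Real.rpow_pos_of_pos hn' _
  have han : a n = σ0 * (∑ k ∈ Finset.range (n + 1), PowerSeries.coeff k H * b (n - k)) - σ0 := by
    rw [eq_sub_iff_add_eq, ha, PowerSeries.coeff_mul,
      Finset.Nat.sum_antidiagonal_eq_sum_range_succ
        (fun i j => PowerSeries.coeff i H * PowerSeries.coeff j (PowerSeries.mk b))]
    simp
  rw [han, show 2 - μ - 1 = 1 - μ by ring]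
  have := (hbpos n).ne'
  change 2 * Real.Gamma (2 - μ) * ((_ / b n) * (b n / _) - _) = _
  field_simp

lemma sibuya_generating_eq {μ u : ℝ} (σ0 : ℝ) (hμ : 0 < μ) (hu : u ∈ Ico (0 : ℝ) 1) :
    σ0 * (1 - (1 - (1 - u) ^ μ)) / ((1 - u) ^ 2 * (1 + (1 - (1 - u) ^ μ))) - σ0 / (1 - u)
      = σ0 * ((1 - u) ^ (μ - 2) / (2 - (1 - u) ^ μ) - 1 / (1 - u)) := by
  have hv : 0 < 1 - u := by linarith [hu.2]
  have h1 : (1 - u) ^ μ ≤ 1 := Real.rpow_le_one hv.le (by linarith [hu.1]) hμ.le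
  have h2 : 2 - (1 - u) ^ μ ≠ 0 := by linarith
  have h3 : 1 + (1 - (1 - u) ^ μ) ≠ 0 := by linarith
  rw [Real.rpow_sub hv, Real.rpow_two, show 1 + (1 - (1 - u) ^ μ) = 2 - (1 - u) ^ μ by ring]
  field_simp
  ring

lemma tendsto_sibuya_generating_div {μ σ0 : ℝ} (hμ : μ ∈ Ioo (0 : ℝ) 1) (hσ : σ0 ≠ 0) :
    Tendsto (fun u : ℝ =>
        (σ0 * (1 - (1 - (1 - u) ^ μ)) / ((1 - u) ^ 2 * (1 + (1 - (1 - u) ^ μ)))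
            - σ0 / (1 - u)) / (σ0 / 2 * (1 - u) ^ (μ - 2)))
      (nhdsWithin 1 (Iio 1)) (nhds 1) := by
  have h0 : Tendsto (fun u : ℝ => 1 - u) (nhdsWithin 1 (Iio 1)) (nhds 0) := by
    have : Tendsto (fun u : ℝ => 1 - u) (nhds 1) (nhds (1 - 1)) :=
      tendsto_const_nhds.sub tendsto_id
    rw [sub_self] at this
    exact this.mono_left nhdsWithin_le_nhds
  have hpow : ∀ {p : ℝ}, 0 < p →
      Tendsto (fun u : ℝ => (1 - u) ^ p) (nhdsWithin 1 (Iio 1)) (nhds 0) := fun {p} hp => by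
    have := h0.rpow_const (p := p) (Or.inr hp.le)
    rwa [Real.zero_rpow hp.ne'] at this
  have h1 := ((tendsto_const_nhds (x := (2 : ℝ))).div ((hpow hμ.1).const_sub 2)
    (by norm_num)).sub ((hpow (sub_pos.mpr hμ.2)).const_mul 2)
  norm_num at h1
  refine h1.congr' ?_
  filter_upwards [Ioo_mem_nhdsLT (zero_lt_one' ℝ)] with u hu
  have hv : 0 < 1 - u := by linarith [hu.2]
  have hle : (1 - u) ^ μ ≤ 1 := Real.rpow_le_one hv.le (by linarith [hu.1]) hμ.1.le
  have h2 : 2 - (1 - u) ^ μ ≠ 0 := by linarith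
  have hp : 0 < (1 - u) ^ μ := Real.rpow_pos_of_pos hv _
  rw [sibuya_generating_eq σ0 hμ.1 ⟨hu.1.le, hu.2⟩, Real.rpow_sub hv, Real.rpow_sub hv,
    Real.rpow_two, Real.rpow_one]
  field_simp

/-- A power series whose `tsum` on `[0, 1)` is the given generating function converges absolutely
to it on `(0, 1)`. -/
lemma absHasSum_mk_of_tsum_eq {a : ℕ → ℝ} {F : ℝ → ℝ}
    (ha : ∀ u ∈ Ico (0 : ℝ) 1, ∑' t : ℕ, a t * u ^ t = F u)
    (hF : ∀ᶠ u in nhdsWithin 1 (Iio 1), F u ≠ 0) {u : ℝ} (hu : u ∈ Ioo (0 : ℝ) 1) :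
    AbsHasSum (PowerSeries.mk a) u (F u) := by
  obtain ⟨v, hv0, hv⟩ := (hF.and (Ioo_mem_nhdsLT hu.2)).exists
  have hsv : Summable fun t => a t * v ^ t := by
    by_contra hns
    exact hv0 (by rw [← ha v ⟨(hu.1.trans hv.1).le, hv.2⟩, tsum_eq_zero_of_not_summable hns])
  have hsu : Summable fun t => a t * u ^ t := by
    refine summable_powerSeries_of_norm_lt (w := v) hsv.hasSum.tendsto_sum_nat.cauchySeq ?_
    rw [Real.norm_of_nonneg hu.1.le, Real.norm_of_nonneg (hu.1.trans hv.1).le]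
    exact hv.1
  refine ⟨by simpa using hsu.norm, ?_⟩
  rw [← ha u ⟨hu.1.le, hu.2⟩]
  simpa using hsu.hasSum

/-- For the Sibuya squirrel random walk (`ψ̄_μ(u) = 1-(1-u)^μ`, `μ ∈ (0,1)`), the
generating function `X̄⁽¹⁾` of the expected position simplifies to
`σ̃₀((1-u)^{μ-2}/(2-(1-u)^μ) - 1/(1-u))`, satisfies
`X̄⁽¹⁾(u) ~ (σ̃₀/2)(1-u)^{μ-2}` as `u → 1⁻`, and its coefficients (the expected
positions) satisfy `⟨X_t⟩ ~ (σ̃₀/2) t^{1-μ}/Γ(2-μ)` as `t → ∞`. -/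
theorem stmt_17 (μ σ0 : ℝ) (hμ : μ ∈ Set.Ioo (0:ℝ) 1) (hσ0 : σ0 ∈ ({-1, 1} : Set ℝ)) :
    (∀ u ∈ Set.Ico (0:ℝ) 1,
      σ0 * (1 - (1 - (1 - u) ^ μ)) / ((1 - u) ^ 2 * (1 + (1 - (1 - u) ^ μ))) - σ0 / (1 - u)
        = σ0 * ((1 - u) ^ (μ - 2) / (2 - (1 - u) ^ μ) - 1 / (1 - u))) ∧
    (Tendsto (fun u : ℝ =>
        (σ0 * (1 - (1 - (1 - u) ^ μ)) / ((1 - u) ^ 2 * (1 + (1 - (1 - u) ^ μ)))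
            - σ0 / (1 - u)) / (σ0 / 2 * (1 - u) ^ (μ - 2)))
      (nhdsWithin 1 (Set.Iio 1)) (nhds 1)) ∧
    (∀ a : ℕ → ℝ,
      (∀ u ∈ Set.Ico (0:ℝ) 1,
        ∑' t : ℕ, a t * u ^ t
          = σ0 * (1 - (1 - (1 - u) ^ μ)) / ((1 - u) ^ 2 * (1 + (1 - (1 - u) ^ μ)))
              - σ0 / (1 - u)) →
      Tendsto (fun t : ℕ => a t / (σ0 / 2 * (t : ℝ) ^ (1 - μ) / Real.Gamma (2 - μ)))
        atTop (nhds 1)) := by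
  have hσ : σ0 ≠ 0 := by
    rcases hσ0 with h | h
    · rw [h]; norm_num
    · rw [Set.mem_singleton_iff.mp h]; norm_num
  have hlim := tendsto_sibuya_generating_div hμ hσ
  refine ⟨fun u hu => sibuya_generating_eq σ0 hμ.1 hu, hlim, fun a ha => ?_⟩
  obtain ⟨H, hH, hinv⟩ := exists_inverse_two_sub hμ
  have hne := hlim.eventually_ne one_ne_zero
  have hA := fun u hu => absHasSum_mk_of_tsum_eq ha
    (hne.mono fun u h h0 => h (by rw [h0, zero_div])) (u := u) hu
  have hprod : (PowerSeries.mk a + PowerSeries.C σ0 * PowerSeries.mk (Ring.multichoose 1)) *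
      (PowerSeries.C 2 - PowerSeries.mk (Ring.multichoose (-μ))) =
      PowerSeries.C σ0 * PowerSeries.mk (Ring.multichoose (2 - μ)) := by
    refine AbsHasSum.ext (f := fun u => σ0 * (1 - u) ^ (-(2 - μ))) (fun u hu => ?_) fun u hu => ?_
    · have hu1 : |u| < 1 := by rw [abs_of_pos hu.1]; exact hu.2
      have h := ((hA u hu).add ((AbsHasSum.const σ0 u).mul (absHasSum_multichoose 1 hu1))).mul
        ((AbsHasSum.const 2 u).sub (absHasSum_multichoose (-μ) hu1))
      convert h using 1
      have hv : 0 < 1 - u := by linarith [hu.2]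
      have hle : (1 - u) ^ μ ≤ 1 := Real.rpow_le_one hv.le (by linarith [hu.1]) hμ.1.le
      have h2 : 2 - (1 - u) ^ μ ≠ 0 := by linarith
      rw [sibuya_generating_eq σ0 hμ.1 ⟨hu.1.le, hu.2⟩, neg_neg, Real.rpow_neg_one, neg_sub]
      field_simp
      ring
    · have hu1 : |u| < 1 := by rw [abs_of_pos hu.1]; exact hu.2
      exact (AbsHasSum.const σ0 u).mul (absHasSum_multichoose (2 - μ) hu1)
  refine tendsto_of_eq_convolution hμ hσ hH fun n => ?_
  have heq : PowerSeries.mk a + PowerSeries.C σ0 * PowerSeries.mk (Ring.multichoose 1) =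
      PowerSeries.C σ0 * (H * PowerSeries.mk (Ring.multichoose (2 - μ))) := by
    linear_combination H * hprod - (PowerSeries.mk a +
      PowerSeries.C σ0 * PowerSeries.mk (Ring.multichoose 1)) * hinv
  simpa [PowerSeries.coeff_C_mul] using congrArg (PowerSeries.coeff n) heq
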